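/- Suppose the pair predictor p̂₂ is pair-calibrated with grouping function Φ. Then for every x ∈ 𝒳, y ∈ 𝒴, and β ∈ (0,1), the following one-sided (Cantelli-type) bound holds over the equivalence class: P[ p(y|X) < p̂₁(y|x) − sqrt( V̂(y|x) · (1/β − 1) ) | X ∈ [x]_Φ ] ≤ β, where the conditional probability of a set S ⊆ 𝒳 given X ∈ [x]_Φ is (∑_{x' ∈ S ∩ [x]_Φ} μ(x')) / (∑_{x' ∈ [x]_Φ} μ(x')). -/

import Mathlib

open Finset

open scoped Classical

/-- Conditional expectation of `f(X)` given `X ∈ [x]_Φ`, where `X ∼ μ` on a finite set. -/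
noncomputable def groupExp {𝒳 𝒵 : Type*} [Fintype 𝒳] (μ : 𝒳 → ℝ) (Φ : 𝒳 → 𝒵)
    (f : 𝒳 → ℝ) (x : 𝒳) : ℝ :=
  (∑ x' : 𝒳, if Φ x' = Φ x then μ x' * f x' else 0) /
  (∑ x' : 𝒳, if Φ x' = Φ x then μ x' else 0)

/-- Marginal `p̂₁(y|x) = ∑_{y'} p̂₂(y,y'|x)` of a pair predictor. -/
noncomputable def marginal {𝒳 𝒴 : Type*} [Fintype 𝒴] (p2 : 𝒳 → 𝒴 → 𝒴 → ℝ) (x : 𝒳) (y : 𝒴) : ℝ :=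
  ∑ y' : 𝒴, p2 x y y'

/-- Cheat-corrected epistemic variance `V̂(y|x) = p̂₂(y,y|x) − p̂₁(y|x)²`. -/
noncomputable def cheatVar {𝒳 𝒴 : Type*} [Fintype 𝒴] (p2 : 𝒳 → 𝒴 → 𝒴 → ℝ) (x : 𝒳) (y : 𝒴) : ℝ :=
  p2 x y y - (marginal p2 x y) ^ 2

/-- Cheat-corrected epistemic confidence `C(y|x)`. -/
noncomputable def cheatConf {𝒳 𝒴 : Type*} [Fintype 𝒴] (p2 : 𝒳 → 𝒴 → 𝒴 → ℝ) (x : 𝒳) (y : 𝒴) : ℝ :=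
  if 0 < p2 x y y then (marginal p2 x y) ^ 2 / p2 x y y else 0


/-- Cantelli's inequality for a finite weighted family with mean `m` and variance `v`. -/
theorem sum_ite_lt_sub_sqrt_le {ι : Type*} [Fintype ι] (w f : ι → ℝ) (hw : ∀ i, 0 ≤ w i)
    {m v β : ℝ} (hm : ∑ i, w i * (m - f i) = 0)
    (hv : ∑ i, w i * (m - f i) ^ 2 = (∑ i, w i) * v) (hv0 : 0 ≤ v)
    (hβ0 : 0 < β) (hβ1 : β < 1) :
    (∑ i, if f i < m - √(v * (1 / β - 1)) then w i else 0) ≤ β * ∑ i, w i := by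
  have hfac : 0 < 1 / β - 1 := by
    rw [sub_pos, lt_div_iff₀ hβ0]; linarith
  set s := √(v * (1 / β - 1)) with hs
  have hs0 : 0 ≤ s := Real.sqrt_nonneg _
  have hs2 : β * s ^ 2 = v * (1 - β) := by
    rw [hs, Real.sq_sqrt (mul_nonneg hv0 hfac.le)]
    field_simp
  have hW : 0 ≤ ∑ i, w i := Finset.sum_nonneg fun i _ => hw i
  rcases hv0.eq_or_lt with rfl | hvpos
  · have hz : ∀ i, w i * (m - f i) ^ 2 = 0 := by
      have h := (Finset.sum_eq_zero_iff_of_nonneg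
        (fun i _ => mul_nonneg (hw i) (sq_nonneg (m - f i)))).1 (hv.trans (mul_zero _))
      exact fun i => h i (Finset.mem_univ i)
    rw [Finset.sum_eq_zero]
    · exact mul_nonneg hβ0.le hW
    · intro i _
      split_ifs with h
      · rcases mul_eq_zero.1 (hz i) with h0 | h0
        · exact h0
        · have := pow_eq_zero_iff (two_ne_zero) |>.1 h0
          linarith
      · rfl
  · have hspos : 0 < s := Real.sqrt_pos.2 (mul_pos hvpos hfac)
    have hmarkov : (∑ i, if f i < m - s then w i else 0) * s ^ 2 ≤
        ∑ i, w i * ((1 - β) * (m - f i) + β * s) ^ 2 := by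
      rw [Finset.sum_mul]
      refine Finset.sum_le_sum fun i _ => ?_
      split_ifs with h
      · refine mul_le_mul_of_nonneg_left (pow_le_pow_left₀ hs0 ?_ 2) (hw i)
        nlinarith
      · rw [zero_mul]
        exact mul_nonneg (hw i) (sq_nonneg _)
    have hexpand : ∑ i, w i * ((1 - β) * (m - f i) + β * s) ^ 2 =
        (1 - β) ^ 2 * ∑ i, w i * (m - f i) ^ 2 +
          2 * (1 - β) * β * s * ∑ i, w i * (m - f i) + β ^ 2 * s ^ 2 * ∑ i, w i := by
      simp only [Finset.mul_sum, ← Finset.sum_add_distrib]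
      exact Finset.sum_congr rfl fun i _ => by ring
    rw [hexpand, hv, hm] at hmarkov
    refine le_of_mul_le_mul_right (hmarkov.trans_eq ?_) (pow_pos hspos 2)
    linear_combination (-(1 - β) * ∑ i, w i) * hs2

/-- The marginal of a pair-calibrated predictor is the group average of the true conditional. -/
theorem marginal_eq_groupExp {𝒳 𝒴 𝒵 : Type*} [Fintype 𝒳] [Fintype 𝒴]
    (μ : 𝒳 → ℝ) (p : 𝒳 → 𝒴 → ℝ) (hp1 : ∀ x, ∑ y, p x y = 1)
    (p2 : 𝒳 → 𝒴 → 𝒴 → ℝ) (Φ : 𝒳 → 𝒵)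
    (hcal : ∀ x y₁ y₂, p2 x y₁ y₂ = groupExp μ Φ (fun x' => p x' y₁ * p x' y₂) x)
    (x : 𝒳) (y : 𝒴) : marginal p2 x y = groupExp μ Φ (fun x' => p x' y) x := by
  simp only [marginal, hcal, groupExp]
  rw [← Finset.sum_div, Finset.sum_comm]
  congr 1
  refine Finset.sum_congr rfl fun x' _ => ?_
  split_ifs
  · rw [← Finset.mul_sum, ← Finset.mul_sum, hp1, mul_one]
  · exact Finset.sum_const_zero

/-- Cantelli-type one-sided bound over the equivalence class, for a
pair-calibrated pair predictor. -/
theorem stmt_13 {𝒳 𝒴 𝒵 : Type*} [Fintype 𝒳] [Fintype 𝒴] [Nonempty 𝒳] [Nonempty 𝒴]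
    (μ : 𝒳 → ℝ) (hμpos : ∀ x, 0 < μ x) (hμsum : ∑ x, μ x = 1)
    (p : 𝒳 → 𝒴 → ℝ) (hp0 : ∀ x y, 0 ≤ p x y) (hp1 : ∀ x, ∑ y, p x y = 1)
    (p2 : 𝒳 → 𝒴 → 𝒴 → ℝ)
    (hp20 : ∀ x y₁ y₂, 0 ≤ p2 x y₁ y₂) (hp21 : ∀ x, ∑ y₁, ∑ y₂, p2 x y₁ y₂ = 1)
    (Φ : 𝒳 → 𝒵)
    (hcal : ∀ x y₁ y₂, p2 x y₁ y₂ = groupExp μ Φ (fun x' => p x' y₁ * p x' y₂) x) :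
    ∀ (x : 𝒳) (y : 𝒴) (β : ℝ), 0 < β → β < 1 →
      (∑ x' : 𝒳, if Φ x' = Φ x ∧
            p x' y < marginal p2 x y - Real.sqrt (cheatVar p2 x y * (1 / β - 1))
          then μ x' else 0) /
        (∑ x' : 𝒳, if Φ x' = Φ x then μ x' else 0) ≤ β := by
  intro x y β hβ0 hβ1
  set w : 𝒳 → ℝ := fun x' => if Φ x' = Φ x then μ x' else 0 with hwdef
  have hw : ∀ i, 0 ≤ w i := fun i => by
    simp only [hwdef]
    split_ifs
    exacts [(hμpos i).le, le_rfl]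
  have hW : 0 < ∑ i, w i :=
    Finset.sum_pos' (fun i _ => hw i) ⟨x, Finset.mem_univ x, by simp [hwdef, hμpos x]⟩
  have hexp : ∀ f : 𝒳 → ℝ, ∑ i, w i * f i = (∑ i, w i) * groupExp μ Φ f x := fun f => by
    rw [groupExp, mul_div_cancel₀ _ hW.ne']
    exact Finset.sum_congr rfl fun i _ => by simp only [hwdef, ite_mul, zero_mul]
  have hmean : ∑ i, w i * p i y = (∑ i, w i) * marginal p2 x y := by
    rw [marginal_eq_groupExp μ p hp1 p2 Φ hcal, hexp]
  have hsecond : ∑ i, w i * (p i y * p i y) = (∑ i, w i) * p2 x y y := by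
    rw [hcal, hexp]
  have hm : ∑ i, w i * (marginal p2 x y - p i y) = 0 := by
    simp only [mul_sub, Finset.sum_sub_distrib, ← Finset.sum_mul, hmean, sub_self]
  have hv : ∑ i, w i * (marginal p2 x y - p i y) ^ 2 = (∑ i, w i) * cheatVar p2 x y := by
    have hsplit : ∑ i, w i * (marginal p2 x y - p i y) ^ 2 =
        marginal p2 x y ^ 2 * ∑ i, w i - 2 * marginal p2 x y * ∑ i, w i * p i y +
          ∑ i, w i * (p i y * p i y) := by
      simp only [Finset.mul_sum, ← Finset.sum_add_distrib, ← Finset.sum_sub_distrib]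
      exact Finset.sum_congr rfl fun i _ => by ring
    rw [hsplit, hmean, hsecond, cheatVar]
    ring
  have hv0 : 0 ≤ cheatVar p2 x y :=
    nonneg_of_mul_nonneg_right
      (hv ▸ Finset.sum_nonneg fun i _ => mul_nonneg (hw i) (sq_nonneg _)) hW
  rw [div_le_iff₀ hW]
  refine le_trans (le_of_eq ?_) (sum_ite_lt_sub_sqrt_le w (fun i => p i y) hw hm hv hv0 hβ0 hβ1)
  refine Finset.sum_congr rfl fun i _ => ?_
  simp only [hwdef, ← ite_and, and_comm]
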